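/- Let θ ∈ ℝ, and let S = [s₁,s₂)×[s₃,s₄) and T = [t₁,t₂)×[t₃,t₄) be bounded rectangles with side lengths S₁ := s₂−s₁, S₂ := s₄−s₃, T₁ := t₂−t₁, T₂ := t₄−t₃, all positive. Write ⟨h_S ∘ φ^θ, h_T⟩ := ∫_{ℝ²} h_S(φ^θ(x,y))·h_T(x,y) dxdy, and assume S ∩ φ^θ(top(T)) = ∅. (1) If S ∩ φ^θ(ℓ) = ∅ for each of the three horizontal segments ℓ of T (so S meets at most the rotated vertical segments of T), then: whenever cosθ ≠ 0, |⟨h_S ∘ φ^θ, h_T⟩| ≤ 3·S₂²·|sinθ/cosθ| / (|S|^{1/2}·|T|^{1/2}), and whenever sinθ ≠ 0, |⟨h_S ∘ φ^θ, h_T⟩| ≤ 3·S₁²·|cosθ/sinθ| / (|S|^{1/2}·|T|^{1/2}). (2) If instead S ∩ φ^θ(ℓ) = ∅ for each of the three vertical segments ℓ of T, then: whenever cosθ ≠ 0, |⟨h_S ∘ φ^θ, h_T⟩| ≤ 3·S₁²·|sinθ/cosθ| / (|S|^{1/2}·|T|^{1/2}), and whenever sinθ ≠ 0, |⟨h_S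 ∘ φ^θ, h_T⟩| ≤ 3·S₂²·|cosθ/sinθ| / (|S|^{1/2}·|T|^{1/2}). -/

import Mathlib

open MeasureTheory Set
open scoped ENNReal

noncomputable section

/-- L²-normalized Haar wavelet of the interval `[a, b)`. -/
def haarW (a b : ℝ) (x : ℝ) : ℝ :=
  (Real.sqrt (b - a))⁻¹ *
    ((Ico a ((a + b) / 2)).indicator 1 x - (Ico ((a + b) / 2) b).indicator 1 x)

/-- Rotation of the plane by angle `θ`. -/
def rot (θ : ℝ) (p : ℝ × ℝ) : ℝ × ℝ :=
  (p.1 * Real.cos θ - p.2 * Real.sin θ, p.1 * Real.sin θ + p.2 * Real.cos θ)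

/-- The pairing `⟨h_S ∘ φ^θ, h_T⟩` of a rotated Haar wavelet of the rectangle
`S = [s₁,s₂)×[s₃,s₄)` against the Haar wavelet of `T = [t₁,t₂)×[t₃,t₄)`. -/
def rotPairing (θ s₁ s₂ s₃ s₄ t₁ t₂ t₃ t₄ : ℝ) : ℝ :=
  ∫ q : ℝ × ℝ, (haarW s₁ s₂ (rot θ q).1 * haarW s₃ s₄ (rot θ q).2) *
    (haarW t₁ t₂ q.1 * haarW t₃ t₄ q.2)

section HaarCancellation

variable {a b : ℝ}

lemma measurable_haarW (a b : ℝ) : Measurable (haarW a b) := by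
  unfold haarW
  exact measurable_const.mul ((measurable_one.indicator measurableSet_Ico).sub
    (measurable_one.indicator measurableSet_Ico))

lemma haarW_eq_zero {x : ℝ} (hab : a ≤ b) (hx : x ∉ Ico a b) : haarW a b x = 0 := by
  have h1 : x ∉ Ico a ((a + b) / 2) := fun h => hx ⟨h.1, by linarith [h.2]⟩
  have h2 : x ∉ Ico ((a + b) / 2) b := fun h => hx ⟨by linarith [h.1], h.2⟩
  simp [haarW, h1, h2]

lemma abs_haarW_le (hab : a ≤ b) (x : ℝ) :
    |haarW a b x| ≤ (Ico a b).indicator (fun _ => (√(b - a))⁻¹) x := by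
  by_cases hx : x ∈ Ico a b
  · rw [indicator_of_mem hx, haarW, abs_mul, abs_of_nonneg (by positivity)]
    refine mul_le_of_le_one_right (by positivity) ?_
    by_cases hm : x < (a + b) / 2
    · simp [hx.1, hm, not_le.2 hm]
    · simp [hx.2, hm, not_lt.1 hm]
  · rw [haarW_eq_zero hab hx, indicator_of_notMem hx, abs_zero]

lemma abs_haarW_le_const (hab : a ≤ b) (x : ℝ) : |haarW a b x| ≤ (√(b - a))⁻¹ :=
  (abs_haarW_le hab x).trans (indicator_le_self' (fun _ _ => by positivity) x)

lemma integrable_haarW (hab : a ≤ b) : Integrable (haarW a b) := by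
  refine Integrable.mono' (g := (Ico a b).indicator fun _ => (√(b - a))⁻¹) ?_
    (measurable_haarW a b).aestronglyMeasurable (.of_forall fun x => abs_haarW_le hab x)
  exact (integrableOn_const (by simp)).integrable_indicator measurableSet_Ico

/-- The Haar wavelet gains cancellation against a Lipschitz function. -/
lemma abs_integral_haarW_mul_le (hab : a < b) {F : ℝ → ℝ} {K : ℝ}
    (hF : Continuous F) (hK : ∀ x y, |F x - F y| ≤ K * |x - y|) :
    |∫ x, haarW a b x * F x| ≤ K * (b - a) ^ 2 / 4 / √(b - a) := by
  set m := (a + b) / 2 with hm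
  have ham : a ≤ m := by linarith
  have hmb : m ≤ b := by linarith
  have hi (u v : ℝ) : Integrable ((Ico u v).indicator F) :=
    ((hF.integrableOn_Icc (a := u) (b := v)).mono_set Ico_subset_Icc_self).integrable_indicator
      measurableSet_Ico
  have hIco {u v : ℝ} (huv : u ≤ v) : ∫ x, (Ico u v).indicator F x = ∫ x in u..v, F x := by
    rw [integral_indicator measurableSet_Ico, intervalIntegral.integral_of_le huv,
      integral_Ico_eq_integral_Ioc]
  have hsplit : ∫ x, haarW a b x * F x =
      (√(b - a))⁻¹ * ((∫ x in a..m, F x) - ∫ x in m..b, F x) := by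
    rw [← hIco ham, ← hIco hmb, ← integral_sub (hi _ _) (hi _ _), ← integral_const_mul]
    congr 1 with x
    simp only [haarW, indicator_apply, Pi.one_apply]
    split_ifs <;> ring
  have hshift : ∫ x in m..b, F x = ∫ x in a..m, F (x + (m - a)) := by
    rw [intervalIntegral.integral_comp_add_right]
    congr 1 <;> simp only [hm] <;> ring
  have hbound : |(∫ x in a..m, F x) - ∫ x in m..b, F x| ≤ K * (m - a) * |m - a| := by
    rw [hshift, ← intervalIntegral.integral_sub (hF.intervalIntegrable _ _)
      ((by fun_prop : Continuous fun x => F (x + (m - a))).intervalIntegrable _ _)]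
    refine intervalIntegral.norm_integral_le_of_norm_le_const (E := ℝ) fun x _ => ?_
    refine (hK _ _).trans_eq ?_
    rw [sub_add_cancel_left, abs_neg, abs_of_nonneg (sub_nonneg.2 ham)]
  rw [hsplit, abs_mul, abs_of_nonneg (by positivity : 0 ≤ (√(b - a))⁻¹), div_eq_inv_mul _ √(b - a)]
  refine mul_le_mul_of_nonneg_left (hbound.trans_eq ?_) (by positivity)
  rw [abs_of_nonneg (sub_nonneg.2 ham), hm]
  ring

lemma abs_indicator_Ico_add_sub_le (a b d e z : ℝ) :
    |(Ico a b).indicator (1 : ℝ → ℝ) (z + d) - (Ico a b).indicator 1 (z + e)| ≤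
      (uIcc (a - d) (a - e)).indicator 1 z + (uIcc (b - d) (b - e)).indicator 1 z := by
  classical
  simp only [indicator_apply, Pi.one_apply, mem_Ico, mem_uIcc]
  split_ifs <;> first | (norm_num; done) | grind

lemma integrable_indicator_uIcc (u v : ℝ) : Integrable ((uIcc u v).indicator (1 : ℝ → ℝ)) :=
  (integrableOn_const (C := (1 : ℝ)) (by simp [uIcc])).integrable_indicator measurableSet_uIcc

lemma integral_indicator_uIcc (u v : ℝ) : ∫ x, (uIcc u v).indicator (1 : ℝ → ℝ) x = |v - u| := by
  rw [integral_indicator_one measurableSet_uIcc, Measure.real, Real.volume_interval,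
    ENNReal.toReal_ofReal (abs_nonneg _)]

/-- `L¹` modulus of continuity of the Haar wavelet. -/
lemma integral_abs_haarW_add_sub_le (a b d e : ℝ) :
    ∫ z, |haarW a b (z + d) - haarW a b (z + e)| ≤ 4 * |d - e| / √(b - a) := by
  set m := (a + b) / 2 with hm
  let U : ℝ → ℝ → ℝ := fun t => (uIcc (t - d) (t - e)).indicator 1
  have hU (t : ℝ) : Integrable (U t) := integrable_indicator_uIcc _ _
  have hUint (t : ℝ) : ∫ z, U t z = |d - e| := by
    simp only [U, integral_indicator_uIcc]
    congr 1
    ring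
  have hle (z : ℝ) : |haarW a b (z + d) - haarW a b (z + e)| ≤
      (√(b - a))⁻¹ * ((U a z + U m z) + (U m z + U b z)) := by
    rw [haarW, haarW, ← mul_sub, abs_mul, abs_of_nonneg (by positivity : 0 ≤ (√(b - a))⁻¹)]
    refine mul_le_mul_of_nonneg_left ?_ (by positivity)
    rw [sub_sub_sub_comm]
    exact (abs_sub _ _).trans (add_le_add
      (abs_indicator_Ico_add_sub_le _ _ d e z)
      (abs_indicator_Ico_add_sub_le _ _ d e z))
  have hI : Integrable fun z => (√(b - a))⁻¹ * ((U a z + U m z) + (U m z + U b z)) :=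
    (((hU a).add (hU m)).add ((hU m).add (hU b))).const_mul _
  refine (integral_mono_of_nonneg (.of_forall fun z => abs_nonneg _) hI
    (.of_forall hle)).trans_eq ?_
  have hadd (s t : ℝ) : ∫ z, (U s z + U t z) = |d - e| + |d - e| := by
    rw [integral_add (hU s) (hU t), hUint, hUint]
  rw [integral_const_mul, integral_add (f := fun z => U a z + U m z) (g := fun z => U m z + U b z)
    ((hU a).add (hU m)) ((hU m).add (hU b)), hadd, hadd]
  ring

lemma integrable_haarW_mul_haarW_affine {s₁ s₂ t₁ t₂ : ℝ} (hs : s₁ ≤ s₂) (ht : t₁ ≤ t₂)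
    (A d : ℝ) : Integrable fun x => haarW s₁ s₂ x * haarW t₁ t₂ (A * x + d) :=
  (integrable_haarW hs).mul_bdd (c := (√(t₂ - t₁))⁻¹)
    ((measurable_haarW t₁ t₂).comp (by fun_prop)).aestronglyMeasurable
    (.of_forall fun _ => abs_haarW_le_const ht _)

lemma abs_integral_haarW_mul_haarW_affine_sub_le {s₁ s₂ t₁ t₂ A : ℝ} (hs : s₁ ≤ s₂)
    (ht : t₁ ≤ t₂) (hA : A ≠ 0) (d e : ℝ) :
    |(∫ x, haarW s₁ s₂ x * haarW t₁ t₂ (A * x + d)) -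
      ∫ x, haarW s₁ s₂ x * haarW t₁ t₂ (A * x + e)| ≤
      (√(s₂ - s₁))⁻¹ * (|A|⁻¹ * (4 * |d - e| / √(t₂ - t₁))) := by
  let w : ℝ → ℝ := fun z => |haarW t₁ t₂ (z + d) - haarW t₁ t₂ (z + e)|
  have hw : Integrable w :=
    (((integrable_haarW ht).comp_add_right d).sub ((integrable_haarW ht).comp_add_right e)).abs
  have hwA : Integrable fun x => w (A * x) := hw.comp_mul_left' hA
  rw [← integral_sub (integrable_haarW_mul_haarW_affine hs ht A d)
    (integrable_haarW_mul_haarW_affine hs ht A e)]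
  refine (norm_integral_le_of_norm_le (G := ℝ) (hwA.const_mul (√(s₂ - s₁))⁻¹)
    (.of_forall fun x => ?_)).trans ?_
  · rw [← mul_sub, norm_mul]
    exact mul_le_mul_of_nonneg_right (abs_haarW_le_const hs x) (abs_nonneg _)
  · rw [integral_const_mul, Measure.integral_comp_mul_left, smul_eq_mul, abs_inv]
    gcongr
    exact integral_abs_haarW_add_sub_le t₁ t₂ d e

/-- A two-dimensional Haar wavelet tested against a Haar wavelet composed with a linear form. -/
lemma abs_integral_haarW_mul_haarW_linear_le {s₁ s₂ s₃ s₄ t₁ t₂ A : ℝ} (hs : s₁ < s₂)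
    (hs' : s₃ < s₄) (ht : t₁ < t₂) (hA : A ≠ 0) (B : ℝ) :
    |∫ p : ℝ × ℝ, (haarW s₁ s₂ p.1 * haarW s₃ s₄ p.2) * haarW t₁ t₂ (A * p.1 + B * p.2)| ≤
      (s₄ - s₃) ^ 2 * |B / A| / (√(s₂ - s₁) * √(s₄ - s₃) * √(t₂ - t₁)) := by
  have hInt : Integrable fun p : ℝ × ℝ =>
      (haarW s₁ s₂ p.1 * haarW s₃ s₄ p.2) * haarW t₁ t₂ (A * p.1 + B * p.2) :=
    ((integrable_haarW hs.le).mul_prod (integrable_haarW hs'.le)).mul_bdd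
      (c := (√(t₂ - t₁))⁻¹)
      ((measurable_haarW t₁ t₂).comp (by fun_prop)).aestronglyMeasurable
      (.of_forall fun _ => abs_haarW_le_const ht.le _)
  let F : ℝ → ℝ := fun y => ∫ x, haarW s₁ s₂ x * haarW t₁ t₂ (A * x + B * y)
  let K : ℝ := (√(s₂ - s₁))⁻¹ * (|A|⁻¹ * (4 * |B| / √(t₂ - t₁)))
  have hK (x y : ℝ) : |F x - F y| ≤ K * |x - y| := by
    refine (abs_integral_haarW_mul_haarW_affine_sub_le hs.le ht.le hA _ _).trans_eq ?_
    rw [← mul_sub, abs_mul]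
    ring
  have hK0 : 0 ≤ K := by positivity
  have hF : Continuous F :=
    (LipschitzWith.of_dist_le_mul (K := ⟨K, hK0⟩) fun x y => hK x y).continuous
  have heq : ∫ p : ℝ × ℝ,
      (haarW s₁ s₂ p.1 * haarW s₃ s₄ p.2) * haarW t₁ t₂ (A * p.1 + B * p.2) =
      ∫ y, haarW s₃ s₄ y * F y := by
    rw [Measure.volume_eq_prod, integral_prod_symm _ hInt]
    congr 1 with y
    rw [← integral_const_mul]
    congr 1 with x
    ring
  rw [heq]
  refine (abs_integral_haarW_mul_le hs' hF hK).trans_eq ?_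
  simp only [K, abs_div]
  field_simp

/-- On a convex set which misses the three horizontal segments of a rectangle, the second factor
of the Haar wavelet of the rectangle is constant. -/
lemma exists_haarW_mul_eq_of_convex {t₁ t₂ t₃ t₄ : ℝ} {D : Set (ℝ × ℝ)} (hD : Convex ℝ D)
    (h : t₁ ≤ t₂) (h' : t₃ ≤ t₄)
    (hne : ∀ q ∈ D, q.1 ∈ Icc t₁ t₂ → q.2 ≠ t₃ ∧ q.2 ≠ (t₃ + t₄) / 2 ∧ q.2 ≠ t₄) :
    ∃ ε : ℝ, |ε| ≤ (√(t₄ - t₃))⁻¹ ∧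
      ∀ q ∈ D, haarW t₁ t₂ q.1 * haarW t₃ t₄ q.2 = ε * haarW t₁ t₂ q.1 := by
  by_cases hex : ∃ q ∈ D, q.1 ∈ Ico t₁ t₂
  · obtain ⟨q₀, hq₀, hq₀'⟩ := hex
    refine ⟨haarW t₃ t₄ q₀.2, abs_haarW_le_const h' _, fun q hq => ?_⟩
    by_cases hq' : q.1 ∈ Ico t₁ t₂
    · have hconv : Convex ℝ (D ∩ Prod.fst ⁻¹' Icc t₁ t₂) :=
        hD.inter ((convex_Icc t₁ t₂).linear_preimage (LinearMap.fst ℝ ℝ ℝ))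
      have hord : (Prod.snd '' (D ∩ Prod.fst ⁻¹' Icc t₁ t₂)).OrdConnected :=
        (hconv.linear_image (LinearMap.snd ℝ ℝ ℝ)).ordConnected
      have hm : q.2 ∈ Prod.snd '' (D ∩ Prod.fst ⁻¹' Icc t₁ t₂) :=
        ⟨q, ⟨hq, Ico_subset_Icc_self hq'⟩, rfl⟩
      have hm₀ : q₀.2 ∈ Prod.snd '' (D ∩ Prod.fst ⁻¹' Icc t₁ t₂) :=
        ⟨q₀, ⟨hq₀, Ico_subset_Icc_self hq₀'⟩, rfl⟩
      have key {t : ℝ} (ht : ∀ q ∈ D, q.1 ∈ Icc t₁ t₂ → q.2 ≠ t) : t ≤ q.2 ↔ t ≤ q₀.2 := by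
        have hnot : t ∉ Prod.snd '' (D ∩ Prod.fst ⁻¹' Icc t₁ t₂) := by
          rintro ⟨r, ⟨hr, hr'⟩, rfl⟩
          exact ht r hr hr' rfl
        constructor <;> intro hle <;> by_contra! hlt
        · exact hnot (hord.out hm₀ hm ⟨hlt.le, hle⟩)
        · exact hnot (hord.out hm hm₀ ⟨hlt.le, hle⟩)
      have k₁ := key fun r hr hr' => (hne r hr hr').1
      have k₂ := key fun r hr hr' => (hne r hr hr').2.1
      have k₃ := key fun r hr hr' => (hne r hr hr').2.2
      rw [mul_comm]
      congr 1
      simp only [haarW, indicator_apply, mem_Ico, ← not_le, k₁, k₂, k₃, Pi.one_apply]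
    · rw [haarW_eq_zero h hq', zero_mul, mul_zero]
  · push Not at hex
    refine ⟨0, by simp, fun q hq => ?_⟩
    rw [haarW_eq_zero h (hex q hq), zero_mul, mul_zero]

/-- The rotation `rot θ` as a linear map. -/
def rotLin (θ : ℝ) : ℝ × ℝ →ₗ[ℝ] ℝ × ℝ :=
  Matrix.toLin (Module.Basis.finTwoProd ℝ) (Module.Basis.finTwoProd ℝ)
    !![Real.cos θ, -Real.sin θ; Real.sin θ, Real.cos θ]

lemma rotLin_apply (θ : ℝ) (p : ℝ × ℝ) : rotLin θ p = rot θ p := by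
  rw [rotLin, Matrix.toLin_finTwoProd_apply]
  ext <;> simp only [rot] <;> ring

lemma rot_neg_rot (θ : ℝ) (p : ℝ × ℝ) : rot (-θ) (rot θ p) = p := by
  have h := Real.sin_sq_add_cos_sq θ
  ext <;> simp only [rot, Real.cos_neg, Real.sin_neg]
  · linear_combination p.1 * h
  · linear_combination p.2 * h

lemma notMem_of_inter_rot_image_eq_empty {θ : ℝ} {S X : Set (ℝ × ℝ)} (h : S ∩ rot θ '' X = ∅)
    {q : ℝ × ℝ} (hq : rot θ q ∈ S) : q ∉ X :=
  fun hX => h.subset ⟨hq, mem_image_of_mem _ hX⟩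

lemma measurable_rot (θ : ℝ) : Measurable (rot θ) := by
  unfold rot
  fun_prop

lemma map_rot_volume (θ : ℝ) : Measure.map (rot θ) volume = volume := by
  have hdet : LinearMap.det (rotLin θ) = 1 := by
    rw [rotLin, LinearMap.det_toLin, Matrix.det_fin_two_of]
    linear_combination Real.sin_sq_add_cos_sq θ
  have h := Measure.map_linearMap_addHaar_eq_smul_addHaar (volume : Measure (ℝ × ℝ))
    (f := rotLin θ) (by simp [hdet])
  rw [hdet, show ⇑(rotLin θ) = rot θ from funext (rotLin_apply θ)] at h
  simpa using h

lemma convex_rot_preimage (θ : ℝ) {S : Set (ℝ × ℝ)} (hS : Convex ℝ S) :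
    Convex ℝ (rot θ ⁻¹' S) := by
  rw [← show ⇑(rotLin θ) = rot θ from funext (rotLin_apply θ)]
  exact hS.linear_preimage (rotLin θ)

lemma rotPairing_eq_integral_rot_neg (θ s₁ s₂ s₃ s₄ t₁ t₂ t₃ t₄ : ℝ) :
    rotPairing θ s₁ s₂ s₃ s₄ t₁ t₂ t₃ t₄ =
      ∫ p : ℝ × ℝ, (haarW s₁ s₂ p.1 * haarW s₃ s₄ p.2) *
        (haarW t₁ t₂ (rot (-θ) p).1 * haarW t₃ t₄ (rot (-θ) p).2) := by
  have hm (a b : ℝ) := measurable_haarW a b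
  have hr := measurable_rot (-θ)
  conv_rhs => rw [← map_rot_volume θ]
  rw [integral_map (measurable_rot θ).aemeasurable
    (Measurable.aestronglyMeasurable (by fun_prop))]
  simp only [rot_neg_rot, rotPairing]

/-- If the Haar wavelet of the second rectangle reduces, on the preimage of the first rectangle, to
a multiple of a function `g`, then so does the pairing. -/
lemma rotPairing_eq_of_eqOn {θ s₁ s₂ s₃ s₄ t₁ t₂ t₃ t₄ ε : ℝ} {g : ℝ × ℝ → ℝ}
    (hS₁ : s₁ ≤ s₂) (hS₂ : s₃ ≤ s₄)
    (h : ∀ q ∈ rot θ ⁻¹' (Ico s₁ s₂ ×ˢ Ico s₃ s₄),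
      haarW t₁ t₂ q.1 * haarW t₃ t₄ q.2 = ε * g q) :
    rotPairing θ s₁ s₂ s₃ s₄ t₁ t₂ t₃ t₄ =
      ε * ∫ p : ℝ × ℝ, (haarW s₁ s₂ p.1 * haarW s₃ s₄ p.2) * g (rot (-θ) p) := by
  rw [rotPairing_eq_integral_rot_neg, ← integral_const_mul]
  congr 1 with p
  by_cases h₁ : p.1 ∈ Ico s₁ s₂
  · by_cases h₂ : p.2 ∈ Ico s₃ s₄
    · have hp : rot θ (rot (-θ) p) = p := by simpa using rot_neg_rot (-θ) p
      rw [h (rot (-θ) p) (by rw [mem_preimage, hp]; exact ⟨h₁, h₂⟩)]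
      ring
    · simp [haarW_eq_zero hS₂ h₂]
  · simp [haarW_eq_zero hS₁ h₁]

lemma abs_integral_haarW_mul_haarW_linear_le_swap {s₁ s₂ s₃ s₄ t₁ t₂ B : ℝ} (hs : s₁ < s₂)
    (hs' : s₃ < s₄) (ht : t₁ < t₂) (A : ℝ) (hB : B ≠ 0) :
    |∫ p : ℝ × ℝ, (haarW s₁ s₂ p.1 * haarW s₃ s₄ p.2) * haarW t₁ t₂ (A * p.1 + B * p.2)| ≤
      (s₂ - s₁) ^ 2 * |A / B| / (√(s₂ - s₁) * √(s₄ - s₃) * √(t₂ - t₁)) := by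
  have h := abs_integral_haarW_mul_haarW_linear_le hs' hs ht hB A
  rw [Measure.volume_eq_prod, ← integral_prod_swap] at h
  simp only [Prod.fst_swap, Prod.snd_swap] at h
  rw [Measure.volume_eq_prod, mul_comm √(s₂ - s₁)]
  simpa only [mul_comm (haarW s₁ s₂ _), add_comm (A * _)] using h

/-- Bookkeeping of the normalizing constants. -/
lemma abs_mul_le_three_mul_div {ε I N u v w z : ℝ} (hu : 0 ≤ u) (hw : 0 ≤ w)
    (hN : 0 ≤ N) (hε : |ε| ≤ (√z)⁻¹) (hI : |I| ≤ N / (√u * √v * √w)) :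
    |ε * I| ≤ 3 * N / (√(u * v) * √(w * z)) := by
  rw [abs_mul, Real.sqrt_mul hu, Real.sqrt_mul hw]
  calc |ε| * |I| ≤ (√z)⁻¹ * (N / (√u * √v * √w)) := by gcongr
    _ = 1 * (N / (√u * √v * (√w * √z))) := by rw [one_mul, ← mul_assoc, inv_mul_eq_div, div_div]
    _ ≤ 3 * (N / (√u * √v * (√w * √z))) := by gcongr; norm_num
    _ = _ := by ring

end HaarCancellation

/-- Cases (1) and (2) of Proposition 8.1 of the paper: the cancellation estimate for a
Haar wavelet tested against a rotated Haar wavelet, when `S` avoids the rotated corners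
of `T` and one family of rotated sides of `T`. -/
theorem rotated_haar_cancellation (θ s₁ s₂ s₃ s₄ t₁ t₂ t₃ t₄ : ℝ)
    (hS₁ : s₁ < s₂) (hS₂ : s₃ < s₄) (hT₁ : t₁ < t₂) (hT₂ : t₃ < t₄)
    (htop : (Ico s₁ s₂ ×ˢ Ico s₃ s₄) ∩
        rot θ '' (({t₁, (t₁ + t₂)/2, t₂} : Set ℝ) ×ˢ ({t₃, (t₃ + t₄)/2, t₄} : Set ℝ)) = ∅) :
    -- Case (1): `S` misses the three rotated horizontal segments of `T`.
    (((Ico s₁ s₂ ×ˢ Ico s₃ s₄) ∩ rot θ '' (Icc t₁ t₂ ×ˢ ({t₃} : Set ℝ)) = ∅ ∧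
      (Ico s₁ s₂ ×ˢ Ico s₃ s₄) ∩ rot θ '' (Icc t₁ t₂ ×ˢ ({(t₃ + t₄)/2} : Set ℝ)) = ∅ ∧
      (Ico s₁ s₂ ×ˢ Ico s₃ s₄) ∩ rot θ '' (Icc t₁ t₂ ×ˢ ({t₄} : Set ℝ)) = ∅) →
      ((Real.cos θ ≠ 0 →
        |rotPairing θ s₁ s₂ s₃ s₄ t₁ t₂ t₃ t₄| ≤
          3 * (s₄ - s₃) ^ 2 * |Real.sin θ / Real.cos θ| /
            (Real.sqrt ((s₂ - s₁) * (s₄ - s₃)) * Real.sqrt ((t₂ - t₁) * (t₄ - t₃)))) ∧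
       (Real.sin θ ≠ 0 →
        |rotPairing θ s₁ s₂ s₃ s₄ t₁ t₂ t₃ t₄| ≤
          3 * (s₂ - s₁) ^ 2 * |Real.cos θ / Real.sin θ| /
            (Real.sqrt ((s₂ - s₁) * (s₄ - s₃)) * Real.sqrt ((t₂ - t₁) * (t₄ - t₃)))))) ∧
    -- Case (2): `S` misses the three rotated vertical segments of `T`.
    (((Ico s₁ s₂ ×ˢ Ico s₃ s₄) ∩ rot θ '' (({t₁} : Set ℝ) ×ˢ Icc t₃ t₄) = ∅ ∧
      (Ico s₁ s₂ ×ˢ Ico s₃ s₄) ∩ rot θ '' (({(t₁ + t₂)/2} : Set ℝ) ×ˢ Icc t₃ t₄) = ∅ ∧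
      (Ico s₁ s₂ ×ˢ Ico s₃ s₄) ∩ rot θ '' (({t₂} : Set ℝ) ×ˢ Icc t₃ t₄) = ∅) →
      ((Real.cos θ ≠ 0 →
        |rotPairing θ s₁ s₂ s₃ s₄ t₁ t₂ t₃ t₄| ≤
          3 * (s₂ - s₁) ^ 2 * |Real.sin θ / Real.cos θ| /
            (Real.sqrt ((s₂ - s₁) * (s₄ - s₃)) * Real.sqrt ((t₂ - t₁) * (t₄ - t₃)))) ∧
       (Real.sin θ ≠ 0 →
        |rotPairing θ s₁ s₂ s₃ s₄ t₁ t₂ t₃ t₄| ≤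
          3 * (s₄ - s₃) ^ 2 * |Real.cos θ / Real.sin θ| /
            (Real.sqrt ((s₂ - s₁) * (s₄ - s₃)) * Real.sqrt ((t₂ - t₁) * (t₄ - t₃)))))) := by
  have hconv : Convex ℝ (rot θ ⁻¹' (Ico s₁ s₂ ×ˢ Ico s₃ s₄)) :=
    convex_rot_preimage θ ((convex_Ico s₁ s₂).prod (convex_Ico s₃ s₄))
  refine ⟨fun ⟨h₁, h₂, h₃⟩ => ?_, fun ⟨h₁, h₂, h₃⟩ => ?_⟩
  · obtain ⟨ε, hε, h⟩ := exists_haarW_mul_eq_of_convex hconv hT₁.le hT₂.le fun q hq hq' => by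
      refine ⟨?_, ?_, ?_⟩ <;> intro hq₂
      · exact notMem_of_inter_rot_image_eq_empty h₁ hq ⟨hq', hq₂⟩
      · exact notMem_of_inter_rot_image_eq_empty h₂ hq ⟨hq', hq₂⟩
      · exact notMem_of_inter_rot_image_eq_empty h₃ hq ⟨hq', hq₂⟩
    have hlin (p : ℝ × ℝ) : (rot (-θ) p).1 = Real.cos θ * p.1 + Real.sin θ * p.2 := by
      simp only [rot, Real.cos_neg, Real.sin_neg]
      ring
    rw [rotPairing_eq_of_eqOn (g := fun q => haarW t₁ t₂ q.1) hS₁.le hS₂.le h]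
    simp only [hlin]
    refine ⟨fun hc => ?_, fun hs => ?_⟩ <;> rw [mul_assoc 3]
    · exact abs_mul_le_three_mul_div (by linarith) (by linarith) (by positivity) hε
        (abs_integral_haarW_mul_haarW_linear_le hS₁ hS₂ hT₁ hc _)
    · exact abs_mul_le_three_mul_div (by linarith) (by linarith) (by positivity) hε
        (abs_integral_haarW_mul_haarW_linear_le_swap hS₁ hS₂ hT₁ _ hs)
  · have hconv' : Convex ℝ (Prod.swap ⁻¹' (rot θ ⁻¹' (Ico s₁ s₂ ×ˢ Ico s₃ s₄))) :=
      hconv.linear_preimage (LinearEquiv.prodComm ℝ ℝ ℝ).toLinearMap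
    obtain ⟨ε, hε, h⟩ := exists_haarW_mul_eq_of_convex hconv' hT₂.le hT₁.le fun q hq hq' => by
      refine ⟨?_, ?_, ?_⟩ <;> intro hq₂
      · exact notMem_of_inter_rot_image_eq_empty h₁ hq ⟨hq₂, hq'⟩
      · exact notMem_of_inter_rot_image_eq_empty h₂ hq ⟨hq₂, hq'⟩
      · exact notMem_of_inter_rot_image_eq_empty h₃ hq ⟨hq₂, hq'⟩
    have hlin (p : ℝ × ℝ) : (rot (-θ) p).2 = -Real.sin θ * p.1 + Real.cos θ * p.2 := by
      simp only [rot, Real.cos_neg, Real.sin_neg]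
      ring
    rw [rotPairing_eq_of_eqOn (g := fun q => haarW t₃ t₄ q.2) hS₁.le hS₂.le
      fun q hq => (mul_comm _ _).trans (h q.swap hq)]
    simp only [hlin]
    refine ⟨fun hc => ?_, fun hs => ?_⟩ <;> rw [mul_assoc 3, mul_comm (t₂ - t₁)]
    · refine abs_mul_le_three_mul_div (by linarith) (by linarith) (by positivity) hε ?_
      simpa only [neg_div, abs_neg] using
        abs_integral_haarW_mul_haarW_linear_le_swap hS₁ hS₂ hT₂ (-Real.sin θ) hc
    · refine abs_mul_le_three_mul_div (by linarith) (by linarith) (by positivity) hε ?_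
      simpa only [div_neg, abs_neg] using
        abs_integral_haarW_mul_haarW_linear_le hS₁ hS₂ hT₂ (neg_ne_zero.2 hs) (Real.cos θ)
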